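/- arXiv:2402.00240 — 2 statements merged into one kernel-verified Lean document; each statement's English description precedes it below -/
import Mathlib

section
/- Let n, c_out, c_in ≥ 1 and K ∈ ℂ^{c_out×c_in×n×n} with spatial indices in {0,…,n−1}. Let C ∈ ℂ^{c_out n² × c_in n²} be the multichannel circular convolution matrix with entries C_{(j,u,v),(i,u′,v′)} = K_{j,i,(u′−u) mod n,(v′−v) mod n}, and for a,b ∈ {0,…,n−1} let D_{a,b} ∈ ℂ^{c_out×c_in} have entries (D_{a,b})_{j,i} = Σ_{s,t=0}^{n−1} K_{j,i,s,t} e^{−2πi(as+bt)/n}. Then for every natural number t ≥ 0, σ₁(C) ≤ max_{0≤a,b≤n−1} ( ‖ (D_{a,b}ᴴ D_{a,b})^{2^t} ‖_F )^{2^{-(t+1)}}. -/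
open Matrix

/-- The spectral norm (largest singular value) of a complex matrix, i.e. the operator norm
of the associated linear map between Euclidean spaces. -/
noncomputable def sigma1 {m n : Type*} [Fintype m] [Fintype n] [DecidableEq n]
    (A : Matrix m n ℂ) : ℝ :=
  ‖LinearMap.toContinuousLinearMap (Matrix.toEuclideanLin A)‖

/-- The Frobenius norm of a complex matrix. -/
noncomputable def frob {m n : Type*} [Fintype m] [Fintype n] (A : Matrix m n ℂ) : ℝ :=
  Real.sqrt (∑ i, ∑ j, ‖A i j‖ ^ 2)

open scoped Matrix.Norms.L2Operator in
theorem aux_sigma1_eq {m n : Type*} [Fintype m] [Fintype n] [DecidableEq n]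
    (A : Matrix m n ℂ) : sigma1 A = ‖A‖ := rfl

theorem aux_sigma1_nonneg {m n : Type*} [Fintype m] [Fintype n] [DecidableEq n]
    (A : Matrix m n ℂ) : 0 ≤ sigma1 A := norm_nonneg _

theorem aux_frob_nonneg {m n : Type*} [Fintype m] [Fintype n]
    (A : Matrix m n ℂ) : 0 ≤ frob A := Real.sqrt_nonneg _

theorem aux_sigma1_le {m n : Type*} [Fintype m] [Fintype n] [DecidableEq n]
    (A : Matrix m n ℂ) (M : ℝ) (hM : 0 ≤ M)
    (h : ∀ x : n → ℂ, ∑ j, ‖∑ i, A j i * x i‖ ^ 2 ≤ M ^ 2 * ∑ i, ‖x i‖ ^ 2) :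
    sigma1 A ≤ M := by
  refine ContinuousLinearMap.opNorm_le_bound _ hM fun x => ?_
  refine (sq_le_sq₀ (by positivity) (by positivity)).mp ?_
  rw [mul_pow, EuclideanSpace.norm_sq_eq, EuclideanSpace.norm_sq_eq]
  exact h x

theorem aux_mulVec_le {m n : Type*} [Fintype m] [Fintype n] [DecidableEq n]
    (A : Matrix m n ℂ) (x : n → ℂ) :
    ∑ j, ‖∑ i, A j i * x i‖ ^ 2 ≤ (sigma1 A) ^ 2 * ∑ i, ‖x i‖ ^ 2 := by
  have h := ContinuousLinearMap.le_opNorm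
    (LinearMap.toContinuousLinearMap (Matrix.toEuclideanLin A)) (WithLp.toLp 2 x)
  have h2 := (sq_le_sq₀ (by positivity) (by positivity)).mpr h
  rw [mul_pow, EuclideanSpace.norm_sq_eq, EuclideanSpace.norm_sq_eq] at h2
  exact h2

theorem aux_sigma1_le_frob {m n : Type*} [Fintype m] [Fintype n] [DecidableEq n]
    (A : Matrix m n ℂ) : sigma1 A ≤ frob A := by
  refine aux_sigma1_le A _ (aux_frob_nonneg A) fun x => ?_
  unfold frob
  rw [Real.sq_sqrt (by positivity), Finset.sum_mul]
  refine Finset.sum_le_sum fun j _ => ?_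
  calc ‖∑ i, A j i * x i‖ ^ 2 ≤ (∑ i, ‖A j i‖ * ‖x i‖) ^ 2 := by
        gcongr
        refine (norm_sum_le _ _).trans (le_of_eq ?_)
        simp
    _ ≤ _ := Finset.sum_mul_sq_le_sq_mul_sq _ _ _

open scoped Matrix.Norms.L2Operator in
theorem aux_gram_pow {m n : Type*} [Fintype m] [Fintype n] [DecidableEq n]
    (A : Matrix m n ℂ) (t : ℕ) :
    sigma1 ((Aᴴ * A) ^ (2 ^ t)) = sigma1 A ^ (2 ^ (t + 1)) := by
  have hs : IsSelfAdjoint (Aᴴ * A) := Matrix.isHermitian_conjTranspose_mul_self A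
  rw [aux_sigma1_eq, aux_sigma1_eq, hs.norm_pow_two_pow, Matrix.l2_opNorm_conjTranspose_mul_self,
    ← pow_two, ← pow_mul, pow_succ' 2 t]

theorem aux_block {m n : Type*} [Fintype m] [Fintype n] [DecidableEq n]
    (A : Matrix m n ℂ) (t : ℕ) :
    sigma1 A ≤ (frob ((Aᴴ * A) ^ (2 ^ t))) ^ ((2:ℝ) ^ (-((t:ℝ) + 1))) := by
  have h := aux_sigma1_le_frob ((Aᴴ * A) ^ (2 ^ t))
  rw [aux_gram_pow] at h
  have h2 : (2:ℝ) ^ (-((t:ℝ) + 1)) = (((2 ^ (t + 1) : ℕ) : ℝ))⁻¹ := by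
    rw [Real.rpow_neg (by norm_num)]
    congr 1
    push_cast
    rw [← Real.rpow_natCast]
    push_cast
    rfl
  rw [h2]
  calc sigma1 A = (sigma1 A ^ (2 ^ (t + 1))) ^ (((2 ^ (t + 1) : ℕ) : ℝ))⁻¹ :=
        (Real.pow_rpow_inv_natCast (aux_sigma1_nonneg A) (by positivity)).symm
    _ ≤ _ := Real.rpow_le_rpow (pow_nonneg (aux_sigma1_nonneg A) _) h (by positivity)

theorem aux_parseval {G : Type*} [Fintype G] [DecidableEq G] (χ : G → G → ℂ) (N : ℝ)
    (h : ∀ u v, ∑ p, (starRingEnd ℂ) (χ p u) * χ p v = if u = v then (N : ℂ) else 0)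
    (x : G → ℂ) : ∑ p, ‖∑ u, χ p u * x u‖ ^ 2 = N * ∑ u, ‖x u‖ ^ 2 := by
  have key : ((∑ p, ‖∑ u, χ p u * x u‖ ^ 2 : ℝ) : ℂ) = ((N * ∑ u, ‖x u‖ ^ 2 : ℝ) : ℂ) := by
    push_cast
    simp_rw [← Complex.conj_mul', map_sum, Finset.sum_mul_sum]
    calc ∑ p, ∑ u, ∑ v, (starRingEnd ℂ) (χ p u * x u) * (χ p v * x v)
        = ∑ u, ∑ v, (∑ p, (starRingEnd ℂ) (χ p u) * χ p v) * ((starRingEnd ℂ) (x u) * x v) := by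
          rw [Finset.sum_comm]
          refine Finset.sum_congr rfl fun u _ => ?_
          rw [Finset.sum_comm]
          refine Finset.sum_congr rfl fun v _ => ?_
          rw [Finset.sum_mul]
          refine Finset.sum_congr rfl fun p _ => ?_
          rw [map_mul]; ring
      _ = _ := by
          simp [h, Finset.mul_sum, ite_mul]
  exact_mod_cast key

theorem aux_conv {G J I : Type*} [Fintype G] [DecidableEq G] [AddCommGroup G]
    [Fintype J] [Fintype I] [DecidableEq I]
    (χ : G → G → ℂ) (N : ℝ) (hN : 0 < N)
    (horth : ∀ u v, ∑ p, (starRingEnd ℂ) (χ p u) * χ p v = if u = v then (N : ℂ) else 0)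
    (hχ : ∀ p u u', (starRingEnd ℂ) (χ p (u' - u)) * χ p u' = χ p u)
    (K : J → I → G → ℂ) (C : Matrix (J × G) (I × G) ℂ)
    (hC : ∀ j i u u', C (j, u) (i, u') = K j i (u' - u))
    (D : G → Matrix J I ℂ)
    (hD : ∀ p j i, D p j i = ∑ s, K j i s * (starRingEnd ℂ) (χ p s))
    (M : ℝ) (hM : 0 ≤ M) (hDM : ∀ p, sigma1 (D p) ≤ M) : sigma1 C ≤ M := by
  refine aux_sigma1_le C M hM fun x => ?_
  have hconv : ∀ p j, ∑ u, χ p u * (∑ iu, C (j, u) iu * x iu)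
      = ∑ i, D p j i * ∑ u', χ p u' * x (i, u') := by
    intro p j
    simp_rw [Fintype.sum_prod_type, hC, Finset.mul_sum]
    rw [Finset.sum_comm]
    refine Finset.sum_congr rfl fun i _ => ?_
    rw [Finset.sum_comm]
    refine Finset.sum_congr rfl fun u' _ => ?_
    rw [hD, Finset.sum_mul, ← Equiv.sum_comp (Equiv.subLeft u')]
    refine Finset.sum_congr rfl fun u _ => ?_
    have h5 := hχ p (u' - u) u'
    rw [sub_sub_cancel] at h5
    simp only [Equiv.subLeft_apply, sub_sub_cancel]
    rw [← h5]
    ring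
  have hp : ∀ p, ∑ j, ‖∑ u, χ p u * (∑ iu, C (j, u) iu * x iu)‖ ^ 2 ≤
      M ^ 2 * ∑ i, ‖∑ u', χ p u' * x (i, u')‖ ^ 2 := by
    intro p
    simp_rw [hconv]
    refine (aux_mulVec_le (D p) _).trans ?_
    have := hDM p
    have := aux_sigma1_nonneg (D p)
    gcongr
  have hs := Finset.sum_le_sum fun p (_ : p ∈ Finset.univ) => hp p
  rw [← Finset.mul_sum, Finset.sum_comm,
    Finset.sum_comm (f := fun p i => ‖∑ u', χ p u' * x (i, u')‖ ^ 2)] at hs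
  simp_rw [fun j => aux_parseval χ N horth (fun u => ∑ iu, C (j, u) iu * x iu),
    fun i => aux_parseval χ N horth (fun u => x (i, u)), ← Finset.mul_sum] at hs
  rw [Fintype.sum_prod_type, Fintype.sum_prod_type (f := fun i => ‖x i‖ ^ 2)]
  nlinarith

theorem aux_orth (n : ℕ) (ω : ℂ) (hω : IsPrimitiveRoot ω n)
    (hc : (starRingEnd ℂ) ω * ω = 1) (u v : Fin n) :
    ∑ a : Fin n, (starRingEnd ℂ) (ω ^ ((a : ℕ) * (u : ℕ))) * ω ^ ((a : ℕ) * (v : ℕ))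
      = if u = v then (n : ℂ) else 0 := by
  have hterm : ∀ a : ℕ, (starRingEnd ℂ) (ω ^ (a * (u : ℕ))) * ω ^ (a * (v : ℕ))
      = ((starRingEnd ℂ) ω ^ (u : ℕ) * ω ^ (v : ℕ)) ^ a := by
    intro a
    rw [map_pow, mul_pow, ← pow_mul, ← pow_mul, mul_comm a, mul_comm a]
  simp_rw [hterm]
  split_ifs with h
  · subst h
    simp [← mul_pow, hc]
  · rw [Fin.sum_univ_eq_sum_range (fun a => ((starRingEnd ℂ) ω ^ (u : ℕ) * ω ^ (v : ℕ)) ^ a),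
      geom_sum_eq]
    · have h1 : (((starRingEnd ℂ) ω ^ (u : ℕ) * ω ^ (v : ℕ)) ^ n) = 1 := by
        rw [mul_pow, ← pow_mul, ← pow_mul, mul_comm _ n, mul_comm _ n, pow_mul, pow_mul,
          ← map_pow, hω.pow_eq_one]
        simp
      rw [h1]; simp
    · intro h1
      apply h
      apply Fin.ext
      apply hω.pow_inj u.2 v.2
      have h2 : ω ^ (u : ℕ) * (starRingEnd ℂ) ω ^ (u : ℕ) = 1 := by
        rw [← mul_pow, mul_comm, hc, one_pow]
      calc ω ^ (u : ℕ) = ω ^ (u : ℕ) * ((starRingEnd ℂ) ω ^ (u : ℕ) * ω ^ (v : ℕ)) := by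
            rw [h1, mul_one]
        _ = ω ^ (v : ℕ) := by rw [← mul_assoc, h2, one_mul]

theorem aux_shift (n : ℕ) [NeZero n] (ω : ℂ) (hω : ω ^ n = 1)
    (hc : (starRingEnd ℂ) ω * ω = 1) (a u u' : Fin n) :
    (starRingEnd ℂ) (ω ^ ((a : ℕ) * ((u' - u : Fin n) : ℕ))) * ω ^ ((a : ℕ) * (u' : ℕ))
      = ω ^ ((a : ℕ) * (u : ℕ)) := by
  have h : ω ^ ((a : ℕ) * (u' : ℕ))
      = ω ^ ((a : ℕ) * ((u' - u : Fin n) : ℕ)) * ω ^ ((a : ℕ) * (u : ℕ)) := by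
    rw [← pow_add, ← mul_add, mul_comm, mul_comm (a : ℕ), pow_mul, pow_mul]
    congr 1
    have h3 : (u' : ℕ) = (((u' - u : Fin n) : ℕ) + (u : ℕ)) % n := by
      rw [← Fin.val_add, sub_add_cancel]
    rw [h3, ← pow_mod_orderOf ω (_ % n), ← pow_mod_orderOf ω (_ + _),
      Nat.mod_mod_of_dvd _ (orderOf_dvd_of_pow_eq_one hω)]
  rw [h, ← mul_assoc, map_pow, ← mul_pow, hc, one_pow, one_mul]

/-- Correctness of the Gram-iteration algorithm for circular convolutional layers: the spectral
norm of the multichannel circular convolution matrix is bounded by the maximum over the Fourier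
blocks `D_{a,b}` of the Gram-iteration Frobenius bound. -/
theorem gram_iteration_bound_circular_conv
    (n cout cin : ℕ) (hn : 1 ≤ n) (hcout : 1 ≤ cout) (hcin : 1 ≤ cin)
    (K : Fin cout → Fin cin → Fin n → Fin n → ℂ)
    (C : Matrix (Fin cout × Fin n × Fin n) (Fin cin × Fin n × Fin n) ℂ)
    (hC : ∀ (j : Fin cout) (i : Fin cin) (u v u' v' : Fin n),
      C (j, (u, v)) (i, (u', v')) = K j i (u' - u) (v' - v))
    (D : Fin n → Fin n → Matrix (Fin cout) (Fin cin) ℂ)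
    (hD : ∀ (a b : Fin n) (j : Fin cout) (i : Fin cin),
      D a b j i = ∑ s : Fin n, ∑ t : Fin n,
        K j i s t * Complex.exp (-(2 * Real.pi * Complex.I) *
          (((a:ℕ):ℂ) * ((s:ℕ):ℂ) + ((b:ℕ):ℂ) * ((t:ℕ):ℂ)) / (n:ℂ))) :
    ∀ t : ℕ,
      sigma1 C ≤
        ⨆ a : Fin n, ⨆ b : Fin n,
          (frob (((D a b)ᴴ * D a b) ^ (2 ^ t))) ^ ((2:ℝ) ^ (-((t:ℝ) + 1))) := by
  intro t
  have : NeZero n := ⟨by omega⟩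
  have hn0 : (n : ℂ) ≠ 0 := Nat.cast_ne_zero.mpr (by omega)
  obtain ⟨ω, hωdef⟩ : ∃ ω : ℂ, ω = Complex.exp (2 * Real.pi * Complex.I / n) := ⟨_, rfl⟩
  have hω : IsPrimitiveRoot ω n := hωdef ▸ Complex.isPrimitiveRoot_exp n (by omega)
  have hconj : (starRingEnd ℂ) ω = Complex.exp (-(2 * Real.pi * Complex.I / n)) := by
    rw [hωdef, ← Complex.exp_conj]
    congr 1
    simp [neg_div, map_ofNat]
  have hc : (starRingEnd ℂ) ω * ω = 1 := by
    rw [hconj, hωdef, ← Complex.exp_add]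
    simp
  have hle : ∀ a b, sigma1 (D a b) ≤ ⨆ a : Fin n, ⨆ b : Fin n,
          (frob (((D a b)ᴴ * D a b) ^ (2 ^ t))) ^ ((2:ℝ) ^ (-((t:ℝ) + 1))) := by
    intro a b
    refine (aux_block (D a b) t).trans ?_
    refine le_trans ?_ (le_ciSup (Set.finite_range _).bddAbove a)
    exact le_ciSup (f := fun b => (frob (((D a b)ᴴ * D a b) ^ (2 ^ t))) ^
      ((2:ℝ) ^ (-((t:ℝ) + 1)))) (Set.finite_range _).bddAbove b
  refine aux_conv (G := Fin n × Fin n)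
    (fun p u => ω ^ ((p.1 : ℕ) * (u.1 : ℕ)) * ω ^ ((p.2 : ℕ) * (u.2 : ℕ)))
    ((n : ℝ) * n) (by positivity) ?_ ?_ (fun j i s => K j i s.1 s.2) C
    (fun j i u u' => hC j i u.1 u.2 u'.1 u'.2) (fun p => D p.1 p.2) ?_ _
    ((aux_sigma1_nonneg _).trans (hle 0 0)) (fun p => hle p.1 p.2)
  · rintro ⟨u1, u2⟩ ⟨v1, v2⟩
    have h1 := aux_orth n ω hω hc u1 v1
    have h2 := aux_orth n ω hω hc u2 v2
    calc _ = (∑ a : Fin n, (starRingEnd ℂ) (ω ^ ((a : ℕ) * (u1 : ℕ))) * ω ^ ((a : ℕ) * (v1 : ℕ)))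
          * (∑ a : Fin n, (starRingEnd ℂ) (ω ^ ((a : ℕ) * (u2 : ℕ))) * ω ^ ((a : ℕ) * (v2 : ℕ))) := by
          rw [Finset.sum_mul_sum, Fintype.sum_prod_type]
          refine Finset.sum_congr rfl fun a _ => Finset.sum_congr rfl fun b _ => ?_
          simp only [map_mul]
          ring
      _ = _ := by
          rw [h1, h2]
          by_cases e1 : u1 = v1 <;> by_cases e2 : u2 = v2 <;> simp [e1, e2]
  · rintro ⟨a, b⟩ ⟨u1, u2⟩ ⟨v1, v2⟩
    have h1 := aux_shift n ω hω.pow_eq_one hc a u1 v1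
    have h2 := aux_shift n ω hω.pow_eq_one hc b u2 v2
    simp only [Prod.mk_sub_mk, map_mul]
    rw [← h1, ← h2]
    ring
  · intro p j i
    rw [hD, Fintype.sum_prod_type]
    refine Finset.sum_congr rfl fun s _ => Finset.sum_congr rfl fun r _ => ?_
    congr 1
    rw [← pow_add, map_pow, hconj, ← Complex.exp_nat_mul]
    congr 1
    push_cast
    ring
end

section
/- Let W ∈ ℝ^{p×q} with W ≠ 0. For a natural number t ≥ 0, set G_t = (Wᵀ W)^{2^t} ∈ ℝ^{q×q}, and let R_t ∈ ℝ^{q×q} be the diagonal matrix with (R_t)_{ii} = ( Σ_{j=1}^{q} |(G_t)_{ij}| )^{-2^{-(t+1)}} when Σ_j |(G_t)_{ij}| > 0, and (R_t)_{ii} = 0 otherwise. Then σ₁(W R_t) → 1 as t → ∞. -/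
open Matrix

/-- The spectral norm (largest singular value) of a real matrix, i.e. the operator norm
of the associated linear map between Euclidean spaces. -/
noncomputable def sigma1R {m n : Type*} [Fintype m] [Fintype n] [DecidableEq n]
    (A : Matrix m n ℝ) : ℝ :=
  ‖LinearMap.toContinuousLinearMap (Matrix.toEuclideanLin A)‖

lemma sr_sqrt_mono {q : ℕ} (A B : Matrix (Fin q) (Fin q) ℝ) (hA : A.PosSemidef)
    (hB : B.PosSemidef) (h : (B ^ 2 - A ^ 2).PosSemidef) : (B - A).PosSemidef := by
  have hH : (B - A).IsHermitian := hB.1.sub hA.1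
  rw [hH.posSemidef_iff_eigenvalues_nonneg]
  intro k
  by_contra hk
  have hk' : hH.eigenvalues k < 0 := by simpa using hk
  set l := hH.eigenvalues k with hl
  set v : Fin q → ℝ := ⇑(hH.eigenvectorBasis k) with hv
  have hev : (B - A) *ᵥ v = l • v := hH.mulVec_eigenvectorBasis k
  have hv0 : v ≠ 0 := by
    intro h0
    apply hH.eigenvectorBasis.orthonormal.ne_zero k
    ext i
    exact congrFun h0 i
  have hsub : B ^ 2 - A ^ 2 = B * (B - A) + (B - A) * A := by noncomm_ring
  have h1 := h.dotProduct_mulVec_nonneg v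
  have hT : (B - A)ᵀ = B - A := by simpa [conjTranspose_eq_transpose_of_trivial] using hH.eq
  have hvec : v ᵥ* (B - A) = l • v := by
    rw [← hev, ← vecMul_transpose, hT]
  rw [hsub, add_mulVec, dotProduct_add, ← mulVec_mulVec, ← mulVec_mulVec, hev,
    star_trivial, dotProduct_mulVec v (B - A), hvec, mulVec_smul, dotProduct_smul,
    smul_dotProduct, smul_eq_mul, smul_eq_mul] at h1
  have hA1 := hA.dotProduct_mulVec_nonneg v
  have hB1 := hB.dotProduct_mulVec_nonneg v
  rw [star_trivial] at hA1 hB1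
  have hA0 : v ⬝ᵥ A *ᵥ v = 0 := by nlinarith
  have hB0 : v ⬝ᵥ B *ᵥ v = 0 := by nlinarith
  have hA2 := (hA.dotProduct_mulVec_zero_iff v).1 (by simpa using hA0)
  have hB2 := (hB.dotProduct_mulVec_zero_iff v).1 (by simpa using hB0)
  rw [sub_mulVec, hA2, hB2, sub_zero] at hev
  rcases smul_eq_zero.1 hev.symm with h | h
  · exact hk'.ne h
  · exact hv0 h

lemma sr_root_mono {q : ℕ} (A B : Matrix (Fin q) (Fin q) ℝ) (hA : A.PosSemidef)
    (hB : B.PosSemidef) (t : ℕ) (h : (B ^ (2 ^ t) - A ^ (2 ^ t)).PosSemidef) :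
    (B - A).PosSemidef := by
  induction t with
  | zero => simpa using h
  | succ t ih =>
    apply ih
    apply sr_sqrt_mono _ _ (hA.pow _) (hB.pow _)
    rwa [← pow_mul, ← pow_mul, ← pow_succ]

lemma sr_diag_dom {q : ℕ} (G : Matrix (Fin q) (Fin q) ℝ) (hG : G.IsHermitian) :
    (Matrix.diagonal (fun i => ∑ j, |G i j|) - G).PosSemidef := by
  refine .of_dotProduct_mulVec_nonneg ((isHermitian_diagonal _).sub hG) fun x => ?_
  have hs : ∀ i j, G j i = G i j := fun i j => by simpa using hG.apply i j
  have e1 : ∑ i, ∑ j, |G i j| * x j ^ 2 = ∑ i, ∑ j, |G i j| * x i ^ 2 := by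
    rw [Finset.sum_comm]
    simp only [hs]
  have e2 : ∑ i, ∑ j, G i j * x i * x j ≤
      ∑ i, ∑ j, (|G i j| * x i ^ 2 / 2 + |G i j| * x j ^ 2 / 2) := by
    refine Finset.sum_le_sum fun i _ => Finset.sum_le_sum fun j _ => ?_
    have h1 := neg_abs_le (G i j)
    have h2 := le_abs_self (G i j)
    nlinarith [mul_nonneg (by linarith : (0:ℝ) ≤ |G i j| - G i j) (sq_nonneg (x i + x j)),
      mul_nonneg (by linarith : (0:ℝ) ≤ |G i j| + G i j) (sq_nonneg (x i - x j))]
  simp only [Finset.sum_add_distrib, ← Finset.sum_div] at e2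
  rw [e1] at e2
  have e3 : star x ⬝ᵥ (diagonal (fun i => ∑ j, |G i j|) - G) *ᵥ x =
      ∑ i, ∑ j, |G i j| * x i ^ 2 - ∑ i, ∑ j, G i j * x i * x j := by
    rw [sub_mulVec, dotProduct_sub, star_trivial]
    congr 1
    · simp only [dotProduct, mulVec_diagonal, Finset.mul_sum, Finset.sum_mul]
      exact Finset.sum_congr rfl fun i _ => Finset.sum_congr rfl fun j _ => by ring
    · simp only [dotProduct, mulVec, Finset.mul_sum]
      exact Finset.sum_congr rfl fun i _ => Finset.sum_congr rfl fun j _ => by ring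
  rw [e3]
  linarith

lemma sr_norm_sq {p q : ℕ} (W : Matrix (Fin p) (Fin q) ℝ) (x : Fin q → ℝ) :
    ‖WithLp.toLp 2 (W *ᵥ x)‖ ^ 2 = x ⬝ᵥ (Wᵀ * W) *ᵥ x := by
  rw [EuclideanSpace.real_norm_sq_eq, ← mulVec_mulVec, dotProduct_mulVec, vecMul_transpose]
  simp [dotProduct, sq]

lemma sr_sigma_mulVec {p q : ℕ} (W : Matrix (Fin p) (Fin q) ℝ) (x : Fin q → ℝ) :
    ‖WithLp.toLp 2 (W *ᵥ x)‖ ≤ sigma1R W * ‖WithLp.toLp 2 x‖ :=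
  (LinearMap.toContinuousLinearMap (Matrix.toEuclideanLin W)).le_opNorm (WithLp.toLp 2 x)

open scoped Matrix.Norms.L2Operator in
lemma sr_entry {q : ℕ} (M : Matrix (Fin q) (Fin q) ℝ) (i j : Fin q) : |M i j| ≤ ‖M‖ := by
  have h := l2_opNorm_mulVec M (EuclideanSpace.single j 1)
  have h2 := PiLp.norm_apply_le (WithLp.toLp 2 (M *ᵥ (EuclideanSpace.single j (1:ℝ)).ofLp)) i
  simp at h h2
  exact h2.trans h

open scoped Matrix.Norms.L2Operator in
lemma sr_top {p q : ℕ} (W : Matrix (Fin p) (Fin q) ℝ) (hW : W ≠ 0) :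
    ∃ (s : ℝ) (v : Fin q → ℝ), 0 < s ∧ v ≠ 0 ∧ (Wᵀ * W) *ᵥ v = s ^ 2 • v ∧
      ‖WithLp.toLp 2 (W *ᵥ v)‖ = s * ‖WithLp.toLp 2 v‖ ∧
      ∀ (N : ℕ), 0 < N → ∀ i j, |((Wᵀ * W) ^ N) i j| ≤ s ^ (2 * N) := by
  have hq : Nonempty (Fin q) := by
    by_contra h
    rw [not_nonempty_iff] at h
    exact hW (by ext i j; exact h.elim j)
  have hs : 0 < ‖W‖ := norm_pos_iff.2 hW
  have hAn : ‖Wᵀ * W‖ = ‖W‖ ^ 2 := by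
    have := l2_opNorm_conjTranspose_mul_self W
    rwa [conjTranspose_eq_transpose_of_trivial, ← sq] at this
  set L := LinearMap.toContinuousLinearMap (Matrix.toEuclideanLin W) with hL
  have hLn : ‖L‖ = ‖W‖ := rfl
  obtain ⟨v, hv, hmax⟩ := (isCompact_sphere (0 : EuclideanSpace ℝ (Fin q)) 1).exists_isMaxOn
    (NormedSpace.sphere_nonempty.2 zero_le_one) (f := fun x => ‖L x‖) (by fun_prop)
  have hv1 : ‖v‖ = 1 := by simpa using hv
  have hLv : ‖L v‖ = ‖W‖ := by
    apply le_antisymm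
    · simpa [hv1, hLn] using L.le_opNorm v
    · rw [← hLn]
      refine L.opNorm_le_of_unit_norm (norm_nonneg _) fun x hx => ?_
      exact hmax (by simpa using hx)
  have hWv : ‖WithLp.toLp 2 (W *ᵥ v.ofLp)‖ = ‖W‖ := hLv
  refine ⟨‖W‖, v.ofLp, hs, ?_, ?_, ?_, ?_⟩
  · intro h0
    have : v = 0 := by ext i; exact congrFun h0 i
    simp [this] at hv1
  · have h1 := l2_opNorm_mulVec (Wᵀ * W) v
    rw [hAn, hv1, mul_one] at h1
    have h2 := sr_norm_sq W v.ofLp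
    rw [hWv] at h2
    set a : EuclideanSpace ℝ (Fin q) := WithLp.toLp 2 ((Wᵀ * W) *ᵥ v.ofLp) with ha
    have h3 : inner ℝ a v = ‖W‖ ^ 2 := by
      rw [h2, EuclideanSpace.inner_eq_star_dotProduct]; simp [ha]
    have h4 : ‖a - (‖W‖ ^ 2) • v‖ ^ 2 ≤ 0 := by
      rw [norm_sub_sq_real, inner_smul_right, h3, norm_smul, hv1]
      have h5 : ‖a‖ ≤ ‖W‖ ^ 2 := h1
      have h6 := pow_le_pow_left₀ (norm_nonneg a) h5 2
      simp only [norm_pow, norm_norm]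
      nlinarith
    have h5 : a = (‖W‖ ^ 2) • v := by
      rw [← sub_eq_zero, ← norm_eq_zero]
      exact pow_eq_zero_iff (two_ne_zero) |>.1 (le_antisymm h4 (sq_nonneg _))
    exact congrArg WithLp.ofLp h5
  · rw [hWv]
    have : ‖WithLp.toLp 2 v.ofLp‖ = 1 := hv1
    rw [this, mul_one]
  · intro N hN i j
    refine (sr_entry _ i j).trans ((norm_pow_le' _ hN).trans ?_)
    rw [hAn, pow_mul]

lemma sr_upper {p q : ℕ} (W : Matrix (Fin p) (Fin q) ℝ) (t : ℕ) (r d : Fin q → ℝ)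
    (hr : ∀ i, r i = ∑ j, |((Wᵀ * W) ^ (2 ^ t) : Matrix (Fin q) (Fin q) ℝ) i j|)
    (hd : ∀ i, d i = if 0 < r i then r i ^ (-((2:ℝ) ^ (-((t:ℝ) + 1)))) else 0) :
    sigma1R (W * Matrix.diagonal d) ≤ 1 := by
  have hr0 : ∀ i, 0 ≤ r i := fun i => by rw [hr i]; exact Finset.sum_nonneg fun _ _ => abs_nonneg _
  have hA : (Wᵀ * W).PosSemidef := by
    simpa [conjTranspose_eq_transpose_of_trivial] using posSemidef_conjTranspose_mul_self W
  set D : Fin q → ℝ := fun i => r i ^ (((2 ^ t : ℕ) : ℝ)⁻¹) with hD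
  have hB : (Matrix.diagonal D).PosSemidef :=
    PosSemidef.diagonal fun i => Real.rpow_nonneg (hr0 i) _
  have hpow : Matrix.diagonal D ^ (2 ^ t) = Matrix.diagonal r := by
    rw [diagonal_pow]
    congr 1
    ext i
    exact Real.rpow_inv_natCast_pow (hr0 i) (by positivity)
  have hdom := sr_root_mono _ _ hA hB t (by
    rw [hpow, show r = fun i => ∑ j, |((Wᵀ * W) ^ (2 ^ t) : Matrix (Fin q) (Fin q) ℝ) i j| from funext hr]
    exact sr_diag_dom _ (hA.pow _).1)
  have hDd : ∀ i, D i * d i ^ 2 ≤ 1 := by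
    intro i
    rw [hd]
    split_ifs with h
    · rw [← Real.rpow_natCast, ← Real.rpow_mul h.le, ← Real.rpow_add h]
      apply le_of_eq
      have : (((2 ^ t : ℕ) : ℝ)⁻¹) + -((2:ℝ) ^ (-((t:ℝ) + 1))) * ((2:ℕ):ℝ) = 0 := by
        rw [Real.rpow_neg two_pos.le, Real.rpow_add two_pos, Real.rpow_natCast]
        push_cast
        field_simp
        norm_num
      rw [this, Real.rpow_zero]
    · simp
  refine ContinuousLinearMap.opNorm_le_bound _ zero_le_one fun x => ?_
  rw [one_mul]
  change ‖WithLp.toLp 2 ((W * diagonal d) *ᵥ x.ofLp)‖ ≤ ‖x‖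
  refine (sq_le_sq₀ (by positivity) (by positivity)).1 ?_
  rw [← mulVec_mulVec, sr_norm_sq, EuclideanSpace.real_norm_sq_eq]
  have h := hdom.dotProduct_mulVec_nonneg (diagonal d *ᵥ x.ofLp)
  rw [star_trivial, sub_mulVec, dotProduct_sub, sub_nonneg] at h
  refine h.trans ?_
  simp only [dotProduct, mulVec_diagonal]
  refine Finset.sum_le_sum fun i _ => ?_
  nlinarith [mul_le_mul_of_nonneg_right (hDd i) (sq_nonneg (x.ofLp i))]

lemma sr_lower {p q : ℕ} (W : Matrix (Fin p) (Fin q) ℝ) (hW : W ≠ 0) (t : ℕ) (r d : Fin q → ℝ)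
    (hr : ∀ i, r i = ∑ j, |((Wᵀ * W) ^ (2 ^ t) : Matrix (Fin q) (Fin q) ℝ) i j|)
    (hd : ∀ i, d i = if 0 < r i then r i ^ (-((2:ℝ) ^ (-((t:ℝ) + 1)))) else 0) :
    (q : ℝ) ^ (-((2:ℝ) ^ (-((t:ℝ) + 1)))) ≤ sigma1R (W * Matrix.diagonal d) := by
  have hq : 0 < q := by
    rcases Nat.eq_zero_or_pos q with h | h
    · subst h
      exact absurd (by ext i j; exact j.elim0) hW
    · exact h
  have hq' : (0:ℝ) < q := by exact_mod_cast hq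
  have hr0 : ∀ i, 0 ≤ r i := fun i => by rw [hr i]; exact Finset.sum_nonneg fun _ _ => abs_nonneg _
  obtain ⟨s, v, hs, hv0, hev, hWv, hent⟩ := sr_top W hW
  set e : ℝ := (2:ℝ) ^ (-((t:ℝ) + 1)) with he
  have he0 : 0 < e := by positivity
  have hmul : ((2 * 2 ^ t : ℕ) : ℝ) * e = 1 := by
    rw [he, Real.rpow_neg two_pos.le, Real.rpow_add two_pos, Real.rpow_natCast]
    push_cast
    field_simp
    norm_num
  have hpowv : ∀ N : ℕ, ((Wᵀ * W) ^ N) *ᵥ v = (s ^ 2) ^ N • v := by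
    intro N
    induction N with
    | zero => simp
    | succ n ih => rw [pow_succ, ← mulVec_mulVec, hev, mulVec_smul, ih, smul_smul,
        ← pow_succ']
  have hrle : ∀ i, r i ≤ q * s ^ (2 * 2 ^ t) := by
    intro i
    rw [hr]
    refine (Finset.sum_le_sum fun j _ => hent (2 ^ t) (by positivity) i j).trans ?_
    simp
  have hre : ∀ i, r i ^ e ≤ (q:ℝ) ^ e * s := by
    intro i
    refine (Real.rpow_le_rpow (hr0 i) (hrle i) he0.le).trans (le_of_eq ?_)
    rw [Real.mul_rpow hq'.le (by positivity), ← Real.rpow_natCast, ← Real.rpow_mul hs.le, hmul,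
      Real.rpow_one]
  set x : Fin q → ℝ := fun i => r i ^ e * v i with hx
  have hdx : diagonal d *ᵥ x = v := by
    ext i
    rw [mulVec_diagonal, hd, hx]
    split_ifs with h
    · rw [Real.rpow_neg h.le]
      have : r i ^ e ≠ 0 := (Real.rpow_pos_of_pos h e).ne'
      field_simp
    · have hri : ∑ j, |((Wᵀ * W) ^ (2 ^ t) : Matrix (Fin q) (Fin q) ℝ) i j| = 0 := by
        rw [← hr]; exact le_antisymm (not_lt.1 h) (hr0 i)
      rw [Finset.sum_eq_zero_iff_of_nonneg (fun _ _ => abs_nonneg _)] at hri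
      have h1 := congrFun (hpowv (2 ^ t)) i
      have h2 : (((Wᵀ * W) ^ (2 ^ t)) *ᵥ v) i = 0 := by
        simp only [mulVec, dotProduct]
        refine Finset.sum_eq_zero fun j _ => ?_
        rw [abs_eq_zero.1 (hri j (Finset.mem_univ j)), zero_mul]
      rw [h2, Pi.smul_apply, smul_eq_mul] at h1
      rcases mul_eq_zero.1 h1.symm with h3 | h3
      · exact absurd h3 (by positivity)
      · rw [h3, zero_mul]
  have hxn : ‖WithLp.toLp 2 x‖ ≤ (q:ℝ) ^ e * s * ‖WithLp.toLp 2 v‖ := by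
    refine (sq_le_sq₀ (by positivity) (by positivity)).1 ?_
    rw [mul_pow, EuclideanSpace.real_norm_sq_eq, EuclideanSpace.real_norm_sq_eq, Finset.mul_sum]
    refine Finset.sum_le_sum fun i _ => ?_
    simp only [hx, mul_pow]
    rw [← mul_pow ((q:ℝ) ^ e)]
    exact mul_le_mul_of_nonneg_right
      (pow_le_pow_left₀ (Real.rpow_nonneg (hr0 i) _) (hre i) 2) (sq_nonneg _)
  have hvn : 0 < ‖WithLp.toLp 2 v‖ := by
    rw [norm_pos_iff]
    intro h0
    exact hv0 (congrArg WithLp.ofLp h0)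
  have hmain := sr_sigma_mulVec (W * diagonal d) x
  rw [← mulVec_mulVec, hdx, hWv] at hmain
  have hsig : 0 ≤ sigma1R (W * diagonal d) := norm_nonneg _
  have hfin := hmain.trans (mul_le_mul_of_nonneg_left hxn hsig)
  have hqe : 0 < (q:ℝ) ^ e := Real.rpow_pos_of_pos hq' e
  have h1 : 1 ≤ sigma1R (W * diagonal d) * (q:ℝ) ^ e := by
    have hsv : 0 < s * ‖WithLp.toLp 2 v‖ := by positivity
    refine le_of_mul_le_mul_right ?_ hsv
    linarith
  rw [Real.rpow_neg hq'.le]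
  exact (inv_le_iff_one_le_mul₀ hqe).2 h1

/-- Spectral rescaling, convergence part: for `W ≠ 0`, the spectral norm of the rescaled
matrix `W R_t` tends to `1` as `t → ∞`. -/
theorem spectral_rescaling_tendsto_one
    (p q : ℕ) (W : Matrix (Fin p) (Fin q) ℝ) (hW : W ≠ 0)
    (G : ℕ → Matrix (Fin q) (Fin q) ℝ)
    (hG : ∀ t : ℕ, G t = (Wᵀ * W) ^ (2 ^ t))
    (R : ℕ → Matrix (Fin q) (Fin q) ℝ)
    (hR : ∀ t : ℕ, R t = Matrix.diagonal (fun i : Fin q =>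
      if 0 < ∑ j : Fin q, |G t i j| then
        (∑ j : Fin q, |G t i j|) ^ (-((2:ℝ) ^ (-((t:ℝ) + 1))))
      else (0:ℝ))) :
    Filter.Tendsto (fun t : ℕ => sigma1R (W * R t)) Filter.atTop (nhds 1) := by
  have hq' : (q:ℝ) ≠ 0 := by
    intro h
    have h : q = 0 := by exact_mod_cast h
    subst h
    exact hW (by ext i j; exact j.elim0)
  have hlim : Filter.Tendsto (fun t : ℕ => (q : ℝ) ^ (-((2:ℝ) ^ (-((t:ℝ) + 1)))))
      Filter.atTop (nhds 1) := by
    have h1 : Filter.Tendsto (fun t : ℕ => -((2:ℝ) ^ (-((t:ℝ) + 1)))) Filter.atTop (nhds 0) := by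
      have h2 : (fun t : ℕ => -((2:ℝ) ^ (-((t:ℝ) + 1)))) = fun t : ℕ => -((1 / 2 : ℝ) ^ (t + 1)) := by
        ext t
        rw [Real.rpow_neg two_pos.le, one_div, inv_pow, ← Real.rpow_natCast]
        push_cast
        rfl
      rw [h2]
      have h3 := (tendsto_pow_atTop_nhds_zero_of_lt_one (r := (1 / 2 : ℝ)) (by norm_num)
        (by norm_num)).comp (Filter.tendsto_add_atTop_nat 1)
      simpa using h3.neg
    have h4 := (Real.continuousAt_const_rpow (b := 0) hq').tendsto.comp h1
    simpa [Function.comp_def] using h4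
  refine tendsto_of_tendsto_of_tendsto_of_le_of_le hlim tendsto_const_nhds ?_ ?_
  · intro t
    simp only [hR]
    exact sr_lower W hW t (fun i => ∑ j, |G t i j|) _ (fun i => by rw [hG]) (fun i => rfl)
  · intro t
    simp only [hR]
    exact sr_upper W t (fun i => ∑ j, |G t i j|) _ (fun i => by rw [hG]) (fun i => rfl)
end
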